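/- Let λ > 0 and define the three-body Coulomb-type potential V(x−y, x−z) = λ (|x−y|^{−1}|x−z|^{−1} + |y−z|^{−1}|y−x|^{−1} + |z−x|^{−1}|z−y|^{−1}) for x, y, z ∈ ℝ³. Then there exists a universal constant C > 0 such that for every φ ∈ H¹(ℝ³), ∫_{ℝ³}∫_{ℝ³}∫_{ℝ³} |V(x−y, x−z)|² |φ(x)|² |φ(y)|² |φ(z)|² dx dy dz ≤ C · λ² · ‖φ‖_{H¹}⁶. -/

import Mathlib

open MeasureTheory ENNReal

/-- The `H¹(ℝ³)` norm of `φ`, built from the `L²` norms of `φ` and of its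
gradient `fderiv ℝ φ`. -/
noncomputable def H1Norm (φ : EuclideanSpace ℝ (Fin 3) → ℂ) : ℝ :=
  Real.sqrt ((eLpNorm φ 2 volume).toReal ^ 2 +
    (eLpNorm (fun x => fderiv ℝ φ x) 2 volume).toReal ^ 2)

/-- The three-body Coulomb-type interaction potential
`V(x−y, x−z) = λ (|x−y|⁻¹|x−z|⁻¹ + |y−z|⁻¹|y−x|⁻¹ + |z−x|⁻¹|z−y|⁻¹)`. -/
noncomputable def threeBodyV (lam : ℝ) (x y z : EuclideanSpace ℝ (Fin 3)) : ℝ :=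
  lam * (‖x - y‖⁻¹ * ‖x - z‖⁻¹ + ‖y - z‖⁻¹ * ‖y - x‖⁻¹ + ‖z - x‖⁻¹ * ‖z - y‖⁻¹)

lemma hardy1d_real (f : ℝ → ℂ) (hf : Differentiable ℝ f)
    (hK : IntegrableOn (fun r : ℝ => r ^ 2 * ‖deriv f r‖ ^ 2) (Set.Ioi 0))
    (b : ℝ) (hb : 1 ≤ b) :
    ∫ r in (0:ℝ)..1, ‖f r‖ ^ 2 ≤
      2 * (b ^ 2 * ‖f b‖ ^ 2) + 4 * ∫ r in Set.Ioi (0:ℝ), r ^ 2 * ‖deriv f r‖ ^ 2 := by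
  have hb0 : (0:ℝ) ≤ b := by linarith
  have hfc : Continuous f := hf.continuous
  have hFc : Continuous (fun r => ‖f r‖ ^ 2) := by fun_prop
  have hKi : IntegrableOn (fun r : ℝ => r ^ 2 * ‖deriv f r‖ ^ 2) (Set.Ioc 0 b) :=
    hK.mono_set Set.Ioc_subset_Ioi_self
  have hKi' : IntervalIntegrable (fun r : ℝ => r ^ 2 * ‖deriv f r‖ ^ 2) volume 0 b :=
    (intervalIntegrable_iff_integrableOn_Ioc_of_le hb0).2 hKi
  have hFi : ∀ c d, IntervalIntegrable (fun r => ‖f r‖ ^ 2) volume c d :=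
    fun c d => hFc.intervalIntegrable c d
  have key := intervalIntegral.integral_le_sub_of_hasDeriv_right_of_le (a := 0) (b := b)
    (g := fun r => r * ‖f r‖ ^ 2)
    (g' := fun r => 1 * ‖f r‖ ^ 2 + r * (2 * inner ℝ (f r) (deriv f r)))
    (φ := fun r => (1/2) * ‖f r‖ ^ 2 - 2 * (r ^ 2 * ‖deriv f r‖ ^ 2)) hb0
    (by fun_prop)
    (fun x _ => by
      have h1 := (hf x).hasDerivAt.norm_sq
      exact ((hasDerivAt_id x).mul h1).hasDerivWithinAt)
    (by
      rw [integrableOn_Icc_iff_integrableOn_Ioc,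
        ← intervalIntegrable_iff_integrableOn_Ioc_of_le hb0]
      exact ((hFi 0 b).const_mul _).sub (hKi'.const_mul _))
    (fun x hx => by
      have h1 : |inner ℝ (f x) (deriv f x)| ≤ ‖f x‖ * ‖deriv f x‖ := abs_real_inner_le_norm _ _
      have h2 := (abs_le.1 h1).1
      have hx0 : 0 < x := hx.1
      have h3 := mul_le_mul_of_nonneg_left h2 hx0.le
      nlinarith [sq_nonneg (‖f x‖ - 2 * (x * ‖deriv f x‖))])
  rw [intervalIntegral.integral_sub ((hFi 0 b).const_mul _) (hKi'.const_mul _),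
    intervalIntegral.integral_const_mul, intervalIntegral.integral_const_mul] at key
  have h4 : ∫ r in (0:ℝ)..b, r ^ 2 * ‖deriv f r‖ ^ 2 ≤
      ∫ r in Set.Ioi (0:ℝ), r ^ 2 * ‖deriv f r‖ ^ 2 := by
    rw [intervalIntegral.integral_of_le hb0]
    exact setIntegral_mono_set hK (Filter.Eventually.of_forall fun r => by positivity)
      (Filter.Eventually.of_forall Set.Ioc_subset_Ioi_self)
  have h5 : ∫ r in (0:ℝ)..1, ‖f r‖ ^ 2 ≤ ∫ r in (0:ℝ)..b, ‖f r‖ ^ 2 :=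
    intervalIntegral.integral_mono_interval le_rfl zero_le_one hb
      (Filter.Eventually.of_forall fun r => by positivity) (hFi 0 b)
  have h6 : b * ‖f b‖ ^ 2 ≤ b ^ 2 * ‖f b‖ ^ 2 := by
    gcongr; nlinarith
  simp only [zero_mul, sub_zero] at key
  linarith

lemma enorm_sq_eq {E : Type*} [NormedAddCommGroup E] (x : E) :
    ‖x‖ₑ ^ 2 = ENNReal.ofReal (‖x‖ ^ 2) := by
  rw [ENNReal.ofReal_pow (norm_nonneg _), ofReal_norm]

lemma hardy1d (f : ℝ → ℂ) (hf : Differentiable ℝ f) :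
    ∫⁻ r in Set.Ioi (0:ℝ), ‖f r‖ₑ ^ 2 ≤
      3 * (∫⁻ r in Set.Ioi (0:ℝ), ENNReal.ofReal (r ^ 2) * ‖f r‖ₑ ^ 2) +
      4 * (∫⁻ r in Set.Ioi (0:ℝ), ENNReal.ofReal (r ^ 2) * ‖deriv f r‖ₑ ^ 2) := by
  have hfc : Continuous f := hf.continuous
  have hdm : Measurable (deriv f) := measurable_deriv f
  set A := ∫⁻ r in Set.Ioi (0:ℝ), ENNReal.ofReal (r ^ 2) * ‖f r‖ₑ ^ 2 with hA
  set K := ∫⁻ r in Set.Ioi (0:ℝ), ENNReal.ofReal (r ^ 2) * ‖deriv f r‖ₑ ^ 2 with hKd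
  by_cases hKt : K = ∞
  · simp [hKt]
  have hKe : ∀ r : ℝ, ENNReal.ofReal (r ^ 2) * ‖deriv f r‖ₑ ^ 2 =
      ENNReal.ofReal (r ^ 2 * ‖deriv f r‖ ^ 2) := fun r => by
    rw [enorm_sq_eq, ENNReal.ofReal_mul (by positivity)]
  have hK : IntegrableOn (fun r : ℝ => r ^ 2 * ‖deriv f r‖ ^ 2) (Set.Ioi 0) := by
    refine ⟨by fun_prop, ?_⟩
    rw [hasFiniteIntegral_iff_ofReal (Filter.Eventually.of_forall fun r => by positivity)]
    simp only [← hKe]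
    exact lt_top_iff_ne_top.2 hKt
  have hKeq : ENNReal.ofReal (∫ r in Set.Ioi (0:ℝ), r ^ 2 * ‖deriv f r‖ ^ 2) = K := by
    rw [ofReal_integral_eq_lintegral_ofReal hK (Filter.Eventually.of_forall fun r => by positivity)]
    simp only [← hKe, hKd]
  have hFeq : ENNReal.ofReal (∫ r in (0:ℝ)..1, ‖f r‖ ^ 2) =
      ∫⁻ r in Set.Ioc (0:ℝ) 1, ‖f r‖ₑ ^ 2 := by
    rw [intervalIntegral.integral_of_le zero_le_one, ofReal_integral_eq_lintegral_ofReal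
      ((by fun_prop : Continuous fun r => ‖f r‖ ^ 2).integrableOn_Ioc)
      (Filter.Eventually.of_forall fun r => by positivity)]
    simp only [enorm_sq_eq]
  have hpt : ∀ b ∈ Set.Ioc (1:ℝ) 2, ∫⁻ r in Set.Ioc (0:ℝ) 1, ‖f r‖ₑ ^ 2 ≤
      2 * (ENNReal.ofReal (b ^ 2) * ‖f b‖ₑ ^ 2) + 4 * K := by
    intro b hb
    rw [← hFeq, ← hKeq]
    refine (ENNReal.ofReal_le_ofReal (hardy1d_real f hf hK b hb.1.le)).trans ?_
    refine ENNReal.ofReal_add_le.trans ?_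
    rw [enorm_sq_eq, ENNReal.ofReal_mul (by norm_num), ENNReal.ofReal_mul (by positivity),
      ENNReal.ofReal_mul (by norm_num)]
    simp
  have h01 : ∫⁻ r in Set.Ioc (0:ℝ) 1, ‖f r‖ₑ ^ 2 ≤ 2 * A + 4 * K := by
    calc ∫⁻ r in Set.Ioc (0:ℝ) 1, ‖f r‖ₑ ^ 2
        = ∫⁻ b in Set.Ioc (1:ℝ) 2, (∫⁻ r in Set.Ioc (0:ℝ) 1, ‖f r‖ₑ ^ 2) := by
          rw [setLIntegral_const, Real.volume_Ioc]; norm_num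
      _ ≤ ∫⁻ b in Set.Ioc (1:ℝ) 2, (2 * (ENNReal.ofReal (b ^ 2) * ‖f b‖ₑ ^ 2) + 4 * K) :=
          setLIntegral_mono' measurableSet_Ioc hpt
      _ = 2 * (∫⁻ b in Set.Ioc (1:ℝ) 2, (ENNReal.ofReal (b ^ 2) * ‖f b‖ₑ ^ 2)) + 4 * K := by
          rw [lintegral_add_right _ measurable_const, lintegral_const_mul _ (by fun_prop),
            setLIntegral_const, Real.volume_Ioc]; norm_num
      _ ≤ 2 * A + 4 * K := by
          gcongr
          exact lintegral_mono_set (fun x hx => lt_trans one_pos hx.1 |> Set.mem_Ioi.2)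
  have h1 : ∫⁻ r in Set.Ioi (1:ℝ), ‖f r‖ₑ ^ 2 ≤ A := by
    calc ∫⁻ r in Set.Ioi (1:ℝ), ‖f r‖ₑ ^ 2
        ≤ ∫⁻ r in Set.Ioi (1:ℝ), ENNReal.ofReal (r ^ 2) * ‖f r‖ₑ ^ 2 := by
          refine setLIntegral_mono' measurableSet_Ioi fun r hr => ?_
          have hr' : (1:ℝ) < r := hr
          refine le_mul_of_one_le_left' ?_
          rw [ENNReal.one_le_ofReal]; nlinarith
      _ ≤ A := lintegral_mono_set (Set.Ioi_subset_Ioi zero_le_one)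
  calc ∫⁻ r in Set.Ioi (0:ℝ), ‖f r‖ₑ ^ 2
      ≤ (∫⁻ r in Set.Ioc (0:ℝ) 1, ‖f r‖ₑ ^ 2) + ∫⁻ r in Set.Ioi (1:ℝ), ‖f r‖ₑ ^ 2 := by
        rw [← Set.Ioc_union_Ioi_eq_Ioi (zero_le_one (α := ℝ))]
        exact lintegral_union_le _ _ _
    _ ≤ (2 * A + 4 * K) + A := add_le_add h01 h1
    _ = 3 * A + 4 * K := by ring


lemma lintegral_polar3 (g : (EuclideanSpace ℝ (Fin 3)) → ℝ≥0∞) (hg : Measurable g) :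
    ∫⁻ u, g u = ∫⁻ w, (∫⁻ r in Set.Ioi (0:ℝ), ENNReal.ofReal (r ^ 2) * g (r • (w : (EuclideanSpace ℝ (Fin 3)))))
      ∂((volume : Measure (EuclideanSpace ℝ (Fin 3))).toSphere) := by
  have hmp := (volume : Measure (EuclideanSpace ℝ (Fin 3))).measurePreserving_homeomorphUnitSphereProd
  have hd : Module.finrank ℝ (EuclideanSpace ℝ (Fin 3)) - 1 = 2 := by simp
  rw [hd] at hmp
  have hmeas : Measurable (fun p : Metric.sphere (0 : (EuclideanSpace ℝ (Fin 3))) 1 × Set.Ioi (0:ℝ) =>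
      g ((p.2 : ℝ) • (p.1 : (EuclideanSpace ℝ (Fin 3))))) := by fun_prop
  calc ∫⁻ u, g u = ∫⁻ u in ({0}ᶜ : Set (EuclideanSpace ℝ (Fin 3))), g u := by
        rw [restrict_compl_singleton]
    _ = ∫⁻ u : ({0}ᶜ : Set (EuclideanSpace ℝ (Fin 3))), g u ∂(Measure.comap Subtype.val volume) :=
        (lintegral_subtype_comap (measurableSet_singleton _).compl g).symm
    _ = ∫⁻ u : ({0}ᶜ : Set (EuclideanSpace ℝ (Fin 3))), (fun p : Metric.sphere (0 : (EuclideanSpace ℝ (Fin 3))) 1 × Set.Ioi (0:ℝ) =>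
          g ((p.2 : ℝ) • (p.1 : (EuclideanSpace ℝ (Fin 3))))) (homeomorphUnitSphereProd (EuclideanSpace ℝ (Fin 3)) u)
          ∂(Measure.comap Subtype.val volume) := by
        refine lintegral_congr fun u => ?_
        have h : (u : (EuclideanSpace ℝ (Fin 3))) ≠ 0 := u.2
        have h' : ‖(u : (EuclideanSpace ℝ (Fin 3)))‖ ≠ 0 := norm_ne_zero_iff.2 h
        simp [smul_smul, h']
    _ = _ := by
        rw [hmp.lintegral_comp hmeas, lintegral_prod _ hmeas.aemeasurable]
        refine lintegral_congr fun w => ?_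
        rw [Measure.volumeIoiPow, lintegral_withDensity_eq_lintegral_mul _ (by fun_prop)
          (by fun_prop)]
        exact lintegral_subtype_comap measurableSet_Ioi
          (fun r : ℝ => ENNReal.ofReal (r ^ 2) * g (r • (w : (EuclideanSpace ℝ (Fin 3)))))

lemma hardy3 (φ : (EuclideanSpace ℝ (Fin 3)) → ℂ) (hφ : Differentiable ℝ φ) :
    ∫⁻ u, ENNReal.ofReal (‖u‖⁻¹ ^ 2) * ‖φ u‖ₑ ^ 2 ≤
      3 * (∫⁻ u, ‖φ u‖ₑ ^ 2) + 4 * ∫⁻ u, ‖fderiv ℝ φ u‖ₑ ^ 2 := by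
  have hc : Continuous φ := hφ.continuous
  have hd : Measurable (fderiv ℝ φ) := measurable_fderiv ℝ φ
  have hs : Measurable (fun w : Metric.sphere (0 : (EuclideanSpace ℝ (Fin 3))) 1 => (w : (EuclideanSpace ℝ (Fin 3)))) := measurable_subtype_coe
  rw [lintegral_polar3 _ (by fun_prop), lintegral_polar3 (fun u => ‖φ u‖ₑ ^ 2) (by fun_prop),
    lintegral_polar3 (fun u => ‖fderiv ℝ φ u‖ₑ ^ 2) (by fun_prop)]
  have hm : ∀ g : (EuclideanSpace ℝ (Fin 3)) → ℝ≥0∞, Measurable g → Measurable (fun w : Metric.sphere (0 : (EuclideanSpace ℝ (Fin 3))) 1 =>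
      ∫⁻ r in Set.Ioi (0:ℝ), ENNReal.ofReal (r ^ 2) * g (r • (w : (EuclideanSpace ℝ (Fin 3))))) := fun g hg => by
    refine Measurable.lintegral_prod_right' (f := fun p : Metric.sphere (0 : (EuclideanSpace ℝ (Fin 3))) 1 × ℝ =>
      ENNReal.ofReal (p.2 ^ 2) * g (p.2 • (p.1 : (EuclideanSpace ℝ (Fin 3))))) (by fun_prop)
  rw [← lintegral_const_mul _ (hm (fun u => ‖φ u‖ₑ ^ 2) (by fun_prop)),
    ← lintegral_const_mul _ (hm (fun u => ‖fderiv ℝ φ u‖ₑ ^ 2) (by fun_prop)),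
    ← lintegral_add_left ((hm (fun u => ‖φ u‖ₑ ^ 2) (by fun_prop)).const_mul _)]
  refine lintegral_mono fun w => ?_
  have hw : ‖(w : (EuclideanSpace ℝ (Fin 3)))‖ = 1 := by simp
  have hderiv : ∀ r : ℝ, HasDerivAt (fun r : ℝ => φ (r • (w : (EuclideanSpace ℝ (Fin 3)))))
      (fderiv ℝ φ (r • (w : (EuclideanSpace ℝ (Fin 3)))) (w : (EuclideanSpace ℝ (Fin 3)))) r := fun r => by
    have h1 : HasDerivAt (fun r : ℝ => r • (w : (EuclideanSpace ℝ (Fin 3)))) (w : (EuclideanSpace ℝ (Fin 3))) r := by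
      simpa using (hasDerivAt_id r).smul_const (w : (EuclideanSpace ℝ (Fin 3)))
    exact (hφ _).hasFDerivAt.comp_hasDerivAt r h1
  have h := hardy1d (fun r : ℝ => φ (r • (w : (EuclideanSpace ℝ (Fin 3))))) (fun r => (hderiv r).differentiableAt)
  refine le_trans (le_of_eq ?_) (h.trans ?_)
  · refine setLIntegral_congr_fun measurableSet_Ioi fun r hr => ?_
    have hr' : (0:ℝ) < r := hr
    rw [← mul_assoc, ← ENNReal.ofReal_mul (by positivity), norm_smul, hw, mul_one,
      Real.norm_of_nonneg hr'.le, ← mul_pow, mul_inv_cancel₀ hr'.ne']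
    simp
  · gcongr with r
    rw [(hderiv r).deriv]
    refine (ContinuousLinearMap.le_opENorm _ _).trans ?_
    rw [← ofReal_norm (w : (EuclideanSpace ℝ (Fin 3))), hw]; simp

lemma triple_bound (W : (EuclideanSpace ℝ (Fin 3)) → (EuclideanSpace ℝ (Fin 3)) → ℝ≥0∞) (P : (EuclideanSpace ℝ (Fin 3)) → ℝ≥0∞) (M : ℝ≥0∞)
    (hWm : Measurable (Function.uncurry W)) (hP : Measurable P) (hsym : ∀ x y, W x y = W y x)
    (hM : ∀ x, ∫⁻ y, W x y * P y ≤ M) :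
    ∫⁻ x, ∫⁻ y, ∫⁻ z, (W x y * W x z + W y z * W y x + W z x * W z y) * (P x * P y * P z) ≤
      3 * M ^ 2 * ∫⁻ x, P x := by
  have hW2 : ∀ x, Measurable (W x) := fun x => hWm.comp measurable_prodMk_left
  have hW1 : ∀ y, Measurable (fun x => W x y) := fun y => hWm.comp measurable_prodMk_right
  rw [← lintegral_const_mul _ hP]
  refine lintegral_mono fun x => ?_
  have hin : ∀ y, ∫⁻ z, (W x y * W x z + W y z * W y x + W z x * W z y) * (P x * P y * P z) ≤
      (2 * M * P x) * (W x y * P y) + ∫⁻ z, (P x * (W x z * P z)) * (W z y * P y) := by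
    intro y
    have h1 := hW2 x
    have h2 := hW2 y
    calc ∫⁻ z, (W x y * W x z + W y z * W y x + W z x * W z y) * (P x * P y * P z)
        = ∫⁻ z, (((P x * (W x y * P y)) * (W x z * P z) + (P x * (W x y * P y)) * (W y z * P z)) +
            (P x * (W x z * P z)) * (W z y * P y)) := by
          refine lintegral_congr fun z => ?_
          rw [hsym y x, hsym z x]; ring
      _ = (P x * (W x y * P y)) * (∫⁻ z, W x z * P z) + (P x * (W x y * P y)) *
            (∫⁻ z, W y z * P z) + ∫⁻ z, (P x * (W x z * P z)) * (W z y * P y) := by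
          rw [lintegral_add_left (by fun_prop), lintegral_add_left (by fun_prop),
            lintegral_const_mul _ (by fun_prop), lintegral_const_mul _ (by fun_prop)]
      _ ≤ (P x * (W x y * P y)) * M + (P x * (W x y * P y)) * M +
            ∫⁻ z, (P x * (W x z * P z)) * (W z y * P y) := by
          gcongr
          · exact hM x
          · exact hM y
      _ = _ := by ring
  have hx := hW2 x
  refine (lintegral_mono hin).trans ?_
  rw [lintegral_add_left (by fun_prop), lintegral_const_mul _ (by fun_prop)]
  have hsw : ∫⁻ y, ∫⁻ z, (P x * (W x z * P z)) * (W z y * P y) ≤ M ^ 2 * P x := by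
    rw [lintegral_lintegral_swap]
    · calc ∫⁻ z, ∫⁻ y, (P x * (W x z * P z)) * (W z y * P y)
          = ∫⁻ z, (P x * (W x z * P z)) * ∫⁻ y, (W z y * P y) := by
            refine lintegral_congr fun z => ?_
            have := hW2 z
            rw [lintegral_const_mul _ (by fun_prop)]
        _ ≤ ∫⁻ z, (P x * M) * (W x z * P z) := by
            refine lintegral_mono fun z => ?_
            calc (P x * (W x z * P z)) * ∫⁻ y, (W z y * P y)
                ≤ (P x * (W x z * P z)) * M := by gcongr; exact hM z
              _ = _ := by ring
        _ = (P x * M) * ∫⁻ z, (W x z * P z) := lintegral_const_mul _ (by fun_prop)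
        _ ≤ (P x * M) * M := by gcongr; exact hM x
        _ = _ := by ring
    · have h3 : Measurable (fun p : (EuclideanSpace ℝ (Fin 3)) × (EuclideanSpace ℝ (Fin 3)) => W p.2 p.1) := hWm.comp measurable_swap
      exact (by fun_prop : Measurable (fun p : (EuclideanSpace ℝ (Fin 3)) × (EuclideanSpace ℝ (Fin 3)) =>
        (P x * (W x p.2 * P p.2)) * (W p.2 p.1 * P p.1))).aemeasurable
  calc 2 * M * P x * (∫⁻ y, W x y * P y) + ∫⁻ y, ∫⁻ z, (P x * (W x z * P z)) * (W z y * P y)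
      ≤ 2 * M * P x * M + M ^ 2 * P x := by gcongr; exact hM x
    _ = 3 * M ^ 2 * P x := by ring

lemma lintegral_sq_le {F : Type*} [NormedAddCommGroup F] (g : (EuclideanSpace ℝ (Fin 3)) → F) (hg : MemLp g 2 volume) :
    ∫⁻ x, ‖g x‖ₑ ^ 2 ≤
      ENNReal.ofReal ((eLpNorm g 2 volume).toReal ^ 2) := by
  rw [ENNReal.ofReal_pow ENNReal.toReal_nonneg, ENNReal.ofReal_toReal hg.2.ne,
    eLpNorm_eq_lintegral_rpow_enorm_toReal (by norm_num) (by norm_num)]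
  rw [← ENNReal.rpow_natCast, ← ENNReal.rpow_mul]
  simp

/-- Lemma B.4: the square of the three-body interaction potential tested
against `|φ|²` in each variable is bounded by `C λ² ‖φ‖_{H¹}⁶`. -/
theorem threeBodyV_sq_bound :
    ∃ C : ℝ, 0 < C ∧
      ∀ lam : ℝ, 0 < lam →
      ∀ φ : EuclideanSpace ℝ (Fin 3) → ℂ,
        Differentiable ℝ φ →
        MemLp φ 2 volume →
        MemLp (fun x => fderiv ℝ φ x) 2 volume →
        (∫⁻ x, ∫⁻ y, ∫⁻ z,
            ENNReal.ofReal (|threeBodyV lam x y z| ^ 2) *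
              ((‖φ x‖₊ : ℝ≥0∞) ^ 2 * (‖φ y‖₊ : ℝ≥0∞) ^ 2 * (‖φ z‖₊ : ℝ≥0∞) ^ 2))
          ≤ ENNReal.ofReal (C * lam ^ 2 * H1Norm φ ^ 6) := by
  refine ⟨441, by norm_num, fun lam hlam φ hd h2 h2' => ?_⟩
  have hc : Continuous φ := hd.continuous
  set W : (EuclideanSpace ℝ (Fin 3)) → (EuclideanSpace ℝ (Fin 3)) → ℝ≥0∞ := fun x y => ENNReal.ofReal (‖x - y‖⁻¹ ^ 2) with hW
  set P : (EuclideanSpace ℝ (Fin 3)) → ℝ≥0∞ := fun x => ‖φ x‖ₑ ^ 2 with hP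
  set H := ENNReal.ofReal (H1Norm φ ^ 2) with hH
  have hHsq : H1Norm φ ^ 2 = (eLpNorm φ 2 volume).toReal ^ 2 +
      (eLpNorm (fun x => fderiv ℝ φ x) 2 volume).toReal ^ 2 := Real.sq_sqrt (by positivity)
  have hA : ∫⁻ x, P x ≤ H := (lintegral_sq_le φ h2).trans
    (ENNReal.ofReal_le_ofReal (by rw [hHsq]; exact le_add_of_nonneg_right (by positivity)))
  have hB : ∫⁻ x, ‖fderiv ℝ φ x‖ₑ ^ 2 ≤ H := (lintegral_sq_le _ h2').trans
    (ENNReal.ofReal_le_ofReal (by rw [hHsq]; exact le_add_of_nonneg_left (by positivity)))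
  have hsym : ∀ x y, W x y = W y x := fun x y => by simp only [hW, norm_sub_rev]
  have hM : ∀ x, ∫⁻ y, W x y * P y ≤ 7 * H := by
    intro x
    have h := hardy3 (fun u => φ (x + u)) (by fun_prop)
    have e1 : ∫⁻ y, W x y * P y = ∫⁻ u, ENNReal.ofReal (‖u‖⁻¹ ^ 2) * ‖φ (x + u)‖ₑ ^ 2 := by
      rw [← lintegral_add_left_eq_self _ x]
      simp [hW, hP]
    have e2 : ∫⁻ u, ‖φ (x + u)‖ₑ ^ 2 = ∫⁻ u, P u := lintegral_add_left_eq_self P x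
    have e3 : ∫⁻ u, ‖fderiv ℝ (fun u => φ (x + u)) u‖ₑ ^ 2 = ∫⁻ u, ‖fderiv ℝ φ u‖ₑ ^ 2 := by
      simp only [fderiv_comp_add_left]
      exact lintegral_add_left_eq_self (fun u => ‖fderiv ℝ φ u‖ₑ ^ 2) x
    rw [e1]
    refine h.trans ?_
    rw [e2, e3]
    calc 3 * (∫⁻ u, P u) + 4 * ∫⁻ u, ‖fderiv ℝ φ u‖ₑ ^ 2 ≤ 3 * H + 4 * H := by gcongr
      _ = 7 * H := by ring
  have hT := triple_bound W P (7 * H) (by simp only [hW, Function.uncurry_def]; fun_prop)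
    (by fun_prop) hsym hM
  have hpt : ∀ x y z, ENNReal.ofReal (|threeBodyV lam x y z| ^ 2) *
      ((‖φ x‖₊ : ℝ≥0∞) ^ 2 * (‖φ y‖₊ : ℝ≥0∞) ^ 2 * (‖φ z‖₊ : ℝ≥0∞) ^ 2) ≤
      ENNReal.ofReal (3 * lam ^ 2) *
        ((W x y * W x z + W y z * W y x + W z x * W z y) * (P x * P y * P z)) := by
    intro x y z
    rw [← mul_assoc (ENNReal.ofReal (3 * lam ^ 2))]
    refine mul_le_mul' ?_ le_rfl
    simp only [hW]
    rw [← ENNReal.ofReal_mul (by positivity), ← ENNReal.ofReal_mul (by positivity),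
      ← ENNReal.ofReal_mul (by positivity), ← ENNReal.ofReal_add (by positivity) (by positivity),
      ← ENNReal.ofReal_add (by positivity) (by positivity), ← ENNReal.ofReal_mul (by positivity)]
    refine ENNReal.ofReal_le_ofReal ?_
    rw [sq_abs, threeBodyV, mul_pow, mul_comm (3:ℝ), mul_assoc]
    refine mul_le_mul_of_nonneg_left ?_ (by positivity)
    simp only [← mul_pow]
    generalize ‖x - y‖⁻¹ * ‖x - z‖⁻¹ = a
    generalize ‖y - z‖⁻¹ * ‖y - x‖⁻¹ = b
    generalize ‖z - x‖⁻¹ * ‖z - y‖⁻¹ = c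
    nlinarith [sq_nonneg (a - b), sq_nonneg (b - c), sq_nonneg (a - c)]
  refine (lintegral_mono fun x => lintegral_mono fun y => lintegral_mono fun z =>
    hpt x y z).trans ?_
  simp only [lintegral_const_mul' _ _ ENNReal.ofReal_ne_top]
  calc ENNReal.ofReal (3 * lam ^ 2) * ∫⁻ x, ∫⁻ y, ∫⁻ z,
        (W x y * W x z + W y z * W y x + W z x * W z y) * (P x * P y * P z)
      ≤ ENNReal.ofReal (3 * lam ^ 2) * (3 * (7 * H) ^ 2 * H) := by
        gcongr
        exact hT.trans (by gcongr)
    _ = ENNReal.ofReal (3 * lam ^ 2) * (147 * H ^ 3) := by ring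
    _ = ENNReal.ofReal (441 * lam ^ 2 * H1Norm φ ^ 6) := by
        rw [hH, ← ENNReal.ofReal_pow (by positivity), show (147 : ℝ≥0∞) = ENNReal.ofReal 147 by simp,
          ← ENNReal.ofReal_mul (by norm_num), ← ENNReal.ofReal_mul (by positivity)]
        congr 1; ring
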